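/- arXiv:1711.00935 — 4 statements merged into one kernel-verified Lean document; each statement's English description precedes it below -/
import Mathlib

section
/- For every real x, |cosc x − (x/2)·(1 − (x²/12)·(1 − x²/30))| ≤ |x|⁷/40320. -/
noncomputable def cosc (x : ℝ) : ℝ := if x = 0 then 0 else (1 - Real.cos x) / x

open Finset in
/-- The sum of the first `n` terms of the Taylor series of cosine at `0`. -/
noncomputable def cosPartialSum (n : ℕ) (x : ℝ) : ℝ :=
  ∑ k ∈ range n, (-1) ^ k * x ^ (2 * k) / (2 * k).factorial

open Finset in
/-- The sum of the first `n` terms of the Taylor series of sine at `0`. -/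
noncomputable def sinPartialSum (n : ℕ) (x : ℝ) : ℝ :=
  ∑ k ∈ range n, (-1) ^ k * x ^ (2 * k + 1) / (2 * k + 1).factorial

theorem hasDerivAt_sinPartialSum (n : ℕ) (x : ℝ) :
    HasDerivAt (sinPartialSum n) (cosPartialSum n x) x := by
  refine HasDerivAt.fun_sum fun k _ => ?_
  refine (((hasDerivAt_pow (2 * k + 1) x).const_mul ((-1 : ℝ) ^ k)).div_const
    ((2 * k + 1).factorial : ℝ)).congr_deriv ?_
  have := Nat.factorial_ne_zero (2 * k)
  rw [Nat.factorial_succ]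
  push_cast
  field_simp

theorem hasDerivAt_cosPartialSum_succ (n : ℕ) (x : ℝ) :
    HasDerivAt (cosPartialSum (n + 1)) (-sinPartialSum n x) x := by
  have h : cosPartialSum (n + 1) = fun y => ∑ k ∈ Finset.range n,
      (-1 : ℝ) ^ (k + 1) * y ^ (2 * k + 2) / (2 * k + 2).factorial + 1 := by
    funext y
    simp [cosPartialSum, Finset.sum_range_succ', mul_add]
  rw [h, sinPartialSum, ← Finset.sum_neg_distrib]
  refine (HasDerivAt.fun_sum fun k _ => ?_).add_const 1
  refine (((hasDerivAt_pow (2 * k + 2) x).const_mul ((-1 : ℝ) ^ (k + 1))).div_const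
    ((2 * k + 2).factorial : ℝ)).congr_deriv ?_
  have := Nat.factorial_ne_zero (2 * k + 1)
  rw [Nat.factorial_succ (2 * k + 1), show 2 * k + 2 - 1 = 2 * k + 1 by omega]
  push_cast
  field_simp
  ring

theorem nonneg_of_hasDerivAt_nonneg {f f' : ℝ → ℝ} (hf : ∀ x, HasDerivAt f (f' x) x)
    (h0 : f 0 = 0) (hf' : ∀ x, 0 ≤ x → 0 ≤ f' x) {x : ℝ} (hx : 0 ≤ x) : 0 ≤ f x := by
  have hmono : MonotoneOn f (Set.Ici 0) := by
    refine monotoneOn_of_deriv_nonneg (convex_Ici 0)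
      (fun y _ => (hf y).continuousAt.continuousWithinAt)
      (fun y _ => (hf y).differentiableAt.differentiableWithinAt) fun y hy => ?_
    rw [(hf y).deriv]
    exact hf' y (interior_subset hy)
  exact h0 ▸ hmono Set.self_mem_Ici hx hx

theorem sinPartialSum_error_nonneg {n : ℕ}
    (h : ∀ x : ℝ, 0 ≤ x → 0 ≤ (-1) ^ n * (Real.cos x - cosPartialSum n x))
    {x : ℝ} (hx : 0 ≤ x) : 0 ≤ (-1) ^ n * (Real.sin x - sinPartialSum n x) :=
  nonneg_of_hasDerivAt_nonneg
    (fun y => ((Real.hasDerivAt_sin y).sub (hasDerivAt_sinPartialSum n y)).const_mul _)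
    (by simp [sinPartialSum]) h hx

theorem cosPartialSum_succ_error_nonneg (n : ℕ) {x : ℝ} (hx : 0 ≤ x) :
    0 ≤ (-1) ^ (n + 1) * (Real.cos x - cosPartialSum (n + 1) x) := by
  induction n generalizing x with
  | zero => simp [cosPartialSum, Real.cos_le_one]
  | succ n ih =>
    refine nonneg_of_hasDerivAt_nonneg
      (fun y => ((Real.hasDerivAt_cos y).sub
        (hasDerivAt_cosPartialSum_succ (n + 1) y)).const_mul _)
      (by simp [cosPartialSum, Finset.sum_range_succ']) (fun y hy => ?_) hx
    have := sinPartialSum_error_nonneg (fun z hz => ih hz) hy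
    rw [pow_succ]
    linarith

/-- The error of a nonempty Taylor partial sum of cosine is at most the first omitted term. -/
theorem abs_cos_sub_cosPartialSum_succ_le (n : ℕ) (x : ℝ) :
    |Real.cos x - cosPartialSum (n + 1) x| ≤ |x| ^ (2 * (n + 1)) / (2 * (n + 1)).factorial := by
  have heven : cosPartialSum (n + 1) x = cosPartialSum (n + 1) |x| := by
    simp [cosPartialSum, pow_mul]
  rw [heven, ← Real.cos_abs]
  have h₁ := cosPartialSum_succ_error_nonneg n (abs_nonneg x)
  have h₂ := cosPartialSum_succ_error_nonneg (n + 1) (abs_nonneg x)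
  rw [cosPartialSum, Finset.sum_range_succ, ← cosPartialSum, pow_succ _ (n + 1),
    mul_div_assoc] at h₂
  have h₃ : 0 ≤ |x| ^ (2 * (n + 1)) / (2 * (n + 1)).factorial := by positivity
  rcases neg_one_pow_eq_or ℝ (n + 1) with h | h <;> rw [h] at h₁ h₂ <;> rw [abs_le] <;>
    constructor <;> linarith

theorem cosc_taylor_bound (x : ℝ) :
    |cosc x - (x / 2) * (1 - (x ^ 2 / 12) * (1 - x ^ 2 / 30))| ≤ |x| ^ 7 / 40320 := by
  rcases eq_or_ne x 0 with rfl | hx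
  · simp [cosc]
  have h := abs_cos_sub_cosPartialSum_succ_le 3 x
  have hsum : cosPartialSum 4 x = 1 - x ^ 2 / 2 + x ^ 4 / 24 - x ^ 6 / 720 := by
    simp [cosPartialSum, Finset.sum_range_succ, Nat.factorial]
    ring
  have hcosc : cosc x - (x / 2) * (1 - (x ^ 2 / 12) * (1 - x ^ 2 / 30)) =
      -(Real.cos x - cosPartialSum 4 x) / x := by
    rw [cosc, if_neg hx, hsum]
    field_simp
    ring
  rw [hcosc, abs_div, abs_neg, div_le_iff₀ (abs_pos.mpr hx)]
  calc |Real.cos x - cosPartialSum 4 x| ≤ |x| ^ 8 / 40320 := by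
        simpa [Nat.factorial] using h
    _ = |x| ^ 7 / 40320 * |x| := by ring
end

section
/- Let θ0, θ1, θ⋆ be real numbers and let A be the associated biarc matrix, with θ⋆0 = θ⋆ − θ0 and θ⋆1 = θ⋆ − θ1. Then det A = A11·A22 − A12·A21 = sinc θ⋆1 · cosc θ⋆0 − sinc θ⋆0 · cosc θ⋆1. -/
noncomputable def sinc (x : ℝ) : ℝ := if x = 0 then 1 else Real.sin x / x
/-- The associated biarc matrix. -/
noncomputable def biarcA (θ0 θ1 θs : ℝ) : Matrix (Fin 2) (Fin 2) ℝ :=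
  !![Real.cos θ0 * sinc (θs - θ0) - Real.sin θ0 * cosc (θs - θ0),
     Real.cos θ1 * sinc (θs - θ1) - Real.sin θ1 * cosc (θs - θ1);
     Real.sin θ0 * sinc (θs - θ0) + Real.cos θ0 * cosc (θs - θ0),
     Real.sin θ1 * sinc (θs - θ1) + Real.cos θ1 * cosc (θs - θ1)]

/-- The real part of `exp (iθ) (sinc x + i cosc x) = exp (iφ) (sinc x - i cosc x)`, `x = φ - θ`. -/
theorem cos_mul_sinc_sub_sin_mul_cosc (θ φ : ℝ) :
    Real.cos θ * sinc (φ - θ) - Real.sin θ * cosc (φ - θ) =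
      Real.cos φ * sinc (φ - θ) + Real.sin φ * cosc (φ - θ) := by
  by_cases h : φ - θ = 0
  · simp [sinc, cosc, sub_eq_zero.mp h]
  · simp only [sinc, cosc, h, if_false, Real.sin_sub, Real.cos_sub]
    field_simp
    linear_combination
      Real.sin φ * Real.sin_sq_add_cos_sq θ + Real.sin θ * Real.sin_sq_add_cos_sq φ

/-- The imaginary part of `exp (iθ) (sinc x + i cosc x) = exp (iφ) (sinc x - i cosc x)`,
`x = φ - θ`. -/
theorem sin_mul_sinc_add_cos_mul_cosc (θ φ : ℝ) :
    Real.sin θ * sinc (φ - θ) + Real.cos θ * cosc (φ - θ) =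
      Real.sin φ * sinc (φ - θ) - Real.cos φ * cosc (φ - θ) := by
  by_cases h : φ - θ = 0
  · simp [sinc, cosc, sub_eq_zero.mp h]
  · simp only [sinc, cosc, h, if_false, Real.sin_sub, Real.cos_sub]
    field_simp
    linear_combination
      -Real.cos θ * Real.sin_sq_add_cos_sq φ - Real.cos φ * Real.sin_sq_add_cos_sq θ

theorem biarc_det (θ0 θ1 θs : ℝ) :
    (biarcA θ0 θ1 θs).det =
      biarcA θ0 θ1 θs 0 0 * biarcA θ0 θ1 θs 1 1 -
        biarcA θ0 θ1 θs 0 1 * biarcA θ0 θ1 θs 1 0 ∧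
    (biarcA θ0 θ1 θs).det =
      sinc (θs - θ1) * cosc (θs - θ0) - sinc (θs - θ0) * cosc (θs - θ1) := by
  refine ⟨Matrix.det_fin_two _, ?_⟩
  rw [biarcA, Matrix.det_fin_two_of]
  simp only [cos_mul_sinc_sub_sin_mul_cosc, sin_mul_sinc_add_cos_mul_cosc]
  linear_combination (sinc (θs - θ1) * cosc (θs - θ0) - sinc (θs - θ0) * cosc (θs - θ1)) *
    Real.sin_sq_add_cos_sq θs
end

section
/- Let θ0, θ1 ∈ (−π, π) with θ0 ≠ θ1, and let θ⋆ = −(θ0 + θ1)/2 (the Matlab choice of joint angle in standard form). Then the associated biarc matrix A has nonzero determinant, and consequently there exists a unique pair (s, t) ∈ ℝ² with A·(s, t)ᵀ = (1, 0)ᵀ. -/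
theorem sinc_eq_half (d : ℝ) : sinc d = sinc (d / 2) * Real.cos (d / 2) := by
  rcases eq_or_ne d 0 with rfl | hd
  · simp [sinc]
  · have h : Real.sin d = 2 * Real.sin (d / 2) * Real.cos (d / 2) := by
      rw [← Real.sin_two_mul, mul_div_cancel₀ d two_ne_zero]
    simp only [sinc, hd, div_eq_zero_iff, OfNat.ofNat_ne_zero, or_self, if_false, h]
    field_simp

theorem cosc_eq_half (d : ℝ) : cosc d = sinc (d / 2) * Real.sin (d / 2) := by
  rcases eq_or_ne d 0 with rfl | hd
  · simp [cosc]
  · have h : Real.cos d = 1 - 2 * Real.sin (d / 2) ^ 2 := by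
      rw [Real.sin_sq_eq_half_sub, mul_div_cancel₀ d two_ne_zero]; ring
    simp only [sinc, cosc, hd, div_eq_zero_iff, OfNat.ofNat_ne_zero, or_self, if_false, h]
    field_simp
    ring

theorem sin_ne_zero_of_abs_lt_pi {x : ℝ} (hx : x ≠ 0) (h : |x| < Real.pi) : Real.sin x ≠ 0 :=
  fun hs => hx ((Real.sin_eq_zero_iff_of_lt_of_lt (abs_lt.1 h).1 (abs_lt.1 h).2).1 hs)

theorem sinc_ne_zero_of_abs_lt_pi {x : ℝ} (h : |x| < Real.pi) : sinc x ≠ 0 := by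
  rcases eq_or_ne x 0 with rfl | hx
  · simp [sinc]
  · rw [sinc, if_neg hx]
    exact div_ne_zero (sin_ne_zero_of_abs_lt_pi hx h) hx

theorem det_biarcA (θ0 θ1 θs : ℝ) :
    (biarcA θ0 θ1 θs).det =
      sinc ((θs - θ0) / 2) * sinc ((θs - θ1) / 2) * Real.sin ((θ1 - θ0) / 2) := by
  have h : (θ1 - θ0) / 2 = (θ1 + (θs - θ1) / 2) - (θ0 + (θs - θ0) / 2) := by ring
  rw [biarcA, Matrix.det_fin_two_of, sinc_eq_half (θs - θ0), sinc_eq_half (θs - θ1),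
    cosc_eq_half (θs - θ0), cosc_eq_half (θs - θ1), h, Real.sin_sub, Real.sin_add, Real.sin_add,
    Real.cos_add, Real.cos_add]
  ring

theorem existsUnique_mulVec_pair {K : Type*} [Field K] {A : Matrix (Fin 2) (Fin 2) K}
    (hA : A.det ≠ 0) (b : Fin 2 → K) : ∃! p : K × K, A.mulVec ![p.1, p.2] = b := by
  have hu : IsUnit A.det := hA.isUnit
  refine ⟨((A⁻¹.mulVec b) 0, (A⁻¹.mulVec b) 1), ?_, ?_⟩
  · have h : ![(A⁻¹.mulVec b) 0, (A⁻¹.mulVec b) 1] = A⁻¹.mulVec b := by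
      ext i; fin_cases i <;> rfl
    simp only [h, Matrix.mulVec_mulVec, Matrix.mul_nonsing_inv A hu, Matrix.one_mulVec]
  · rintro ⟨s, t⟩ rfl
    simp only [Matrix.mulVec_mulVec, Matrix.nonsing_inv_mul A hu, Matrix.one_mulVec]
    rfl

theorem biarc_regular_unique_solution (θ0 θ1 : ℝ)
    (h0 : θ0 ∈ Set.Ioo (-Real.pi) Real.pi) (h1 : θ1 ∈ Set.Ioo (-Real.pi) Real.pi)
    (hne : θ0 ≠ θ1) :
    (biarcA θ0 θ1 (-(θ0 + θ1) / 2)).det ≠ 0 ∧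
    ∃! p : ℝ × ℝ, (biarcA θ0 θ1 (-(θ0 + θ1) / 2)).mulVec ![p.1, p.2] = ![1, 0] := by
  obtain ⟨h0l, h0r⟩ := h0
  obtain ⟨h1l, h1r⟩ := h1
  have hdet : (biarcA θ0 θ1 (-(θ0 + θ1) / 2)).det ≠ 0 := by
    rw [det_biarcA]
    refine mul_ne_zero (mul_ne_zero (sinc_ne_zero_of_abs_lt_pi ?_) (sinc_ne_zero_of_abs_lt_pi ?_))
      (sin_ne_zero_of_abs_lt_pi (div_ne_zero (sub_ne_zero.2 hne.symm) two_ne_zero) ?_) <;>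
    · rw [abs_lt]
      constructor <;> linarith
  exact ⟨hdet, existsUnique_mulVec_pair hdet _⟩
end

section
/- Let θ ∈ (−π, π) and consider the singular configuration θ0 = θ1 = θ with the Matlab joint angle θ⋆ = −θ. Then for all reals s, t, the associated biarc matrix A satisfies A·(s, t)ᵀ = (1, 0)ᵀ if and only if (s + t)·sinc θ = 1; in particular solutions exist since sinc θ > 0 for θ ∈ (−π, π). -/
theorem sinc_neg_two_mul (θ : ℝ) : sinc (-θ - θ) = Real.cos θ * sinc θ := by
  by_cases h : θ = 0
  · simp [sinc, h]
  · have h2 : -θ - θ = -(2 * θ) := by ring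
    have h3 : -(2 * θ) ≠ 0 := by simpa using h
    rw [h2, sinc, sinc, if_neg h3, if_neg h, Real.sin_neg, Real.sin_two_mul]
    field_simp

theorem cosc_neg_two_mul (θ : ℝ) : cosc (-θ - θ) = -(Real.sin θ * sinc θ) := by
  by_cases h : θ = 0
  · simp [cosc, h]
  · have h2 : -θ - θ = -(2 * θ) := by ring
    have h3 : -(2 * θ) ≠ 0 := by simpa using h
    rw [h2, cosc, sinc, if_neg h3, if_neg h, Real.cos_neg, Real.cos_two_mul, Real.cos_sq']
    field_simp
    ring

theorem biarcA_self_neg (θ : ℝ) : biarcA θ θ (-θ) = !![sinc θ, sinc θ; 0, 0] := by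
  have h₁ : Real.cos θ * (Real.cos θ * sinc θ) - Real.sin θ * -(Real.sin θ * sinc θ) = sinc θ := by
    linear_combination sinc θ * Real.sin_sq_add_cos_sq θ
  have h₂ : Real.sin θ * (Real.cos θ * sinc θ) + Real.cos θ * -(Real.sin θ * sinc θ) = 0 := by
    ring
  simp only [biarcA, sinc_neg_two_mul, cosc_neg_two_mul, h₁, h₂]

theorem sinc_pos_of_mem_Ioo {θ : ℝ} (hθ : θ ∈ Set.Ioo (-Real.pi) Real.pi) : 0 < sinc θ := by
  rcases lt_trichotomy θ 0 with h | rfl | h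
  · rw [sinc, if_neg h.ne]
    exact div_pos_of_neg_of_neg (Real.sin_neg_of_neg_of_neg_pi_lt h hθ.1) h
  · simp [sinc]
  · rw [sinc, if_neg h.ne']
    exact div_pos (Real.sin_pos_of_pos_of_lt_pi h hθ.2) h

theorem biarcA_self_neg_mulVec_eq_iff (θ s t : ℝ) :
    (biarcA θ θ (-θ)).mulVec ![s, t] = ![1, 0] ↔ (s + t) * sinc θ = 1 := by
  simp [biarcA_self_neg, funext_iff, add_mul]

theorem biarc_singular_consistent (θ : ℝ) (hθ : θ ∈ Set.Ioo (-Real.pi) Real.pi) :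
    (∀ s t : ℝ, (biarcA θ θ (-θ)).mulVec ![s, t] = ![1, 0] ↔ (s + t) * sinc θ = 1) ∧
    0 < sinc θ ∧
    ∃ s t : ℝ, (biarcA θ θ (-θ)).mulVec ![s, t] = ![1, 0] := by
  have hpos := sinc_pos_of_mem_Ioo hθ
  refine ⟨biarcA_self_neg_mulVec_eq_iff θ, hpos, (sinc θ)⁻¹, 0, ?_⟩
  rw [biarcA_self_neg_mulVec_eq_iff, add_zero, inv_mul_cancel₀ hpos.ne']
end
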